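/- Let O = ⋃_{t ∈ GF(q)} E_t(τ_{P_λ}(U)) be the orbit of the pedal τ_{P_λ}(U) under the elation group {E_t : t ∈ GF(q)}. For each s ∈ GF(q), let ℓ_s be the line of PG(2,q²) through the points [1,0,0] and [0, s−e, 1]. Then O = ⋃_{s ∈ GF(q)} (ℓ_s ∩ U), and the q sets ℓ_s ∩ U (s ∈ GF(q)) are pairwise disjoint; in particular, these q lines through [1,0,0] partition O and each of them meets U entirely inside O. -/

import Mathlib

noncomputable section
open Projectivization
open scoped LinearAlgebra.Projectivization

/-- `Pt K` is the point set of `PG(2, q²)`, i.e. the projectivization of `K³`. -/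
abbrev Pt (K : Type) [Field K] : Type := ℙ K (Fin 3 → K)

lemma vec1_ne_zero {K : Type} [Field K] (a b : K) : ![a, b, (1 : K)] ≠ 0 := by
  intro h
  have := congrFun h 2
  simp at this

lemma vecInf_ne_zero {K : Type} [Field K] : ![(0 : K), 1, 0] ≠ 0 := by
  intro h
  have := congrFun h 1
  simp at this

lemma vec100_ne_zero {K : Type} [Field K] : ![(1 : K), 0, 0] ≠ 0 := by
  intro h
  have := congrFun h 0
  simp at this

/-- The orthogonal-Buekenhout-Metz unital
`U = {[x, αx² + βN(x) + r, 1] : x ∈ K, r ∈ GF(q)} ∪ {[0,1,0]}`,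
where `GF(q) = {r : r^q = r}` and `N(x) = x^(q+1)`. -/
def unital (K : Type) [Field K] (q : ℕ) (α β : K) : Set (Pt K) :=
  {P | (∃ x r : K, r ^ q = r ∧
      P = Projectivization.mk K ![x, α * x ^ 2 + β * x ^ (q + 1) + r, 1] (vec1_ne_zero _ _)) ∨
    P = Projectivization.mk K ![0, 1, 0] vecInf_ne_zero}

/-- The line through two points `A`, `B`: all points `[w]` with `w ∈ span{u, v}` where
`A = [u]`, `B = [v]`. -/
def lineThrough {K : Type} [Field K] (A B : Pt K) : Set (Pt K) :=
  {C | C.submodule ≤ A.submodule ⊔ B.submodule}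

/-- The pedal `τ_P(U)` of `P`: the set of feet of `P`, i.e. points `A ∈ U` such that `A`
is the only point of `U` on the line through `P` and `A`. -/
def pedal {K : Type} [Field K] (U : Set (Pt K)) (P : Pt K) : Set (Pt K) :=
  {A | A ∈ U ∧ lineThrough P A ∩ U = {A}}

/-- The invertible linear map `(x, y, z) ↦ (x, y + tz, z)` of `K³`. -/
def elationEquiv (K : Type) [Field K] (t : K) : (Fin 3 → K) ≃ₗ[K] (Fin 3 → K) where
  toFun v := ![v 0, v 1 + t * v 2, v 2]
  invFun v := ![v 0, v 1 - t * v 2, v 2]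
  map_add' u v := by
    ext i
    fin_cases i <;> simp <;> ring
  map_smul' c v := by
    ext i
    fin_cases i <;> simp <;> ring
  left_inv v := by
    ext i
    fin_cases i <;> simp
  right_inv v := by
    ext i
    fin_cases i <;> simp

/-- The elation `E_t` of `PG(2, q²)` induced by `(x, y, z) ↦ (x, y + tz, z)`. -/
def elation (K : Type) [Field K] (t : K) : Pt K → Pt K :=
  Projectivization.map (elationEquiv K t).toLinearMap (elationEquiv K t).injective

section Coordinates

variable {K : Type} [Field K]

lemma mk_affine_inj {x y x' y' : K} :
    Projectivization.mk K ![x, y, 1] (vec1_ne_zero _ _) =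
      Projectivization.mk K ![x', y', 1] (vec1_ne_zero _ _) ↔ x = x' ∧ y = y' := by
  constructor
  · intro h
    obtain ⟨a, ha⟩ := (Projectivization.mk_eq_mk_iff' K _ _ _ _).1 h
    have h0 := congrFun ha 0
    have h1 := congrFun ha 1
    have h2 := congrFun ha 2
    simp at h0 h1 h2
    subst h2
    simp at h0 h1
    exact ⟨h0.symm, h1.symm⟩
  · rintro ⟨rfl, rfl⟩
    rfl

lemma mk_affine_ne_inf {x y : K} :
    Projectivization.mk K ![x, y, 1] (vec1_ne_zero _ _) ≠
      Projectivization.mk K ![0, 1, 0] vecInf_ne_zero := by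
  intro h
  obtain ⟨a, ha⟩ := (Projectivization.mk_eq_mk_iff' K _ _ _ _).1 h
  have h2 := congrFun ha 2
  simp at h2

lemma mk_mem_lineThrough {u v w : Fin 3 → K} (hu : u ≠ 0) (hv : v ≠ 0) (hw : w ≠ 0) :
    Projectivization.mk K w hw ∈
      lineThrough (Projectivization.mk K u hu) (Projectivization.mk K v hv) ↔
      ∃ a b : K, a • u + b • v = w := by
  simp only [lineThrough, Set.mem_ofPred_eq, Projectivization.submodule_mk]
  rw [Submodule.span_singleton_le_iff_mem, ← Submodule.span_union, Set.singleton_union,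
    Submodule.mem_span_pair]

lemma affine_mem_lineThrough_affine {x₁ y₁ x₂ y₂ x y : K} :
    Projectivization.mk K ![x, y, 1] (vec1_ne_zero _ _) ∈
      lineThrough (Projectivization.mk K ![x₁, y₁, 1] (vec1_ne_zero _ _))
        (Projectivization.mk K ![x₂, y₂, 1] (vec1_ne_zero _ _)) ↔
      ∃ m : K, x = (1 - m) * x₁ + m * x₂ ∧ y = (1 - m) * y₁ + m * y₂ := by
  rw [mk_mem_lineThrough]
  constructor
  · rintro ⟨a, b, h⟩
    have h0 := congrFun h 0
    have h1 := congrFun h 1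
    have h2 := congrFun h 2
    simp at h0 h1 h2
    obtain rfl : a = 1 - b := by linear_combination h2
    exact ⟨b, h0.symm, h1.symm⟩
  · rintro ⟨m, rfl, rfl⟩
    refine ⟨1 - m, m, ?_⟩
    ext i
    fin_cases i <;> simp

lemma inf_mem_lineThrough_affine {x₁ y₁ x₂ y₂ : K} :
    Projectivization.mk K ![0, 1, 0] vecInf_ne_zero ∈
      lineThrough (Projectivization.mk K ![x₁, y₁, 1] (vec1_ne_zero _ _))
        (Projectivization.mk K ![x₂, y₂, 1] (vec1_ne_zero _ _)) ↔
      x₁ = x₂ ∧ y₁ ≠ y₂ := by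
  rw [mk_mem_lineThrough]
  constructor
  · rintro ⟨a, b, h⟩
    have h0 := congrFun h 0
    have h1 := congrFun h 1
    have h2 := congrFun h 2
    simp at h0 h1 h2
    obtain rfl : a = -b := by linear_combination h2
    have hb : b ≠ 0 := by
      rintro rfl
      simp at h1
    refine ⟨mul_left_cancel₀ hb (by linear_combination -h0), ?_⟩
    rintro rfl
    simp at h1
  · rintro ⟨rfl, hy⟩
    have hy' := sub_ne_zero.2 hy
    refine ⟨(y₁ - y₂)⁻¹, -(y₁ - y₂)⁻¹, ?_⟩
    ext i
    fin_cases i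
    · simp
    · simp
      field_simp
      ring
    · simp

lemma affine_mem_lineThrough_horizontal {x y c : K} :
    Projectivization.mk K ![x, y, 1] (vec1_ne_zero _ _) ∈
      lineThrough (Projectivization.mk K ![1, 0, 0] vec100_ne_zero)
        (Projectivization.mk K ![0, c, 1] (vec1_ne_zero _ _)) ↔ y = c := by
  rw [mk_mem_lineThrough]
  constructor
  · rintro ⟨a, b, h⟩
    have h1 := congrFun h 1
    have h2 := congrFun h 2
    simp at h1 h2
    simp [← h1, h2]
  · rintro rfl
    refine ⟨x, 1, ?_⟩
    ext i
    fin_cases i <;> simp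

lemma inf_notMem_lineThrough_horizontal {c : K} :
    Projectivization.mk K ![0, 1, 0] vecInf_ne_zero ∉
      lineThrough (Projectivization.mk K ![1, 0, 0] vec100_ne_zero)
        (Projectivization.mk K ![0, c, 1] (vec1_ne_zero _ _)) := by
  rw [mk_mem_lineThrough]
  rintro ⟨a, b, h⟩
  have h1 := congrFun h 1
  have h2 := congrFun h 2
  simp at h1 h2
  simp [h2] at h1

lemma elation_mk_affine (t x y : K) :
    elation K t (Projectivization.mk K ![x, y, 1] (vec1_ne_zero _ _)) =
      Projectivization.mk K ![x, y + t, 1] (vec1_ne_zero _ _) := by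
  rw [elation, Projectivization.map_mk]
  congr 1
  simp [elationEquiv]

end Coordinates

section Pedal

variable {K : Type} [Field K]

/-- The form `f(x) - σ(f(x))`, where `f(x) = αx² + βxσ(x)` and `σ` is an involution of `K`. -/
def skewForm (σ : K →+* K) (α β x : K) : K :=
  α * x ^ 2 - σ α * σ x ^ 2 + (β - σ β) * (x * σ x)

lemma skewForm_eq_zero {σ : K →+* K} (hσ : ∀ x, σ (σ x) = x) {α β x : K}
    (hns : ¬ ∃ s : K, σ s = s ∧ 4 * (σ α * α) + (σ β - β) ^ 2 = s ^ 2)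
    (h : skewForm σ α β x = 0) : x = 0 := by
  by_contra hx
  have hx' : σ x ≠ 0 := (map_ne_zero σ).2 hx
  refine hns ⟨(α * x ^ 2 + σ α * σ x ^ 2) / (x * σ x), ?_, ?_⟩
  · simp only [map_div₀, map_add, map_mul, map_pow, hσ]
    congr 1 <;> ring
  · rw [div_pow, eq_div_iff (by positivity)]
    unfold skewForm at h
    linear_combination (-(α * x ^ 2 - σ α * σ x ^ 2) + (β - σ β) * (x * σ x)) * h

lemma map_skewForm {σ : K →+* K} (hσ : ∀ x, σ (σ x) = x) (α β x : K) :
    σ (skewForm σ α β x) = -skewForm σ α β x := by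
  simp only [skewForm, map_add, map_sub, map_mul, map_pow, hσ]
  ring

lemma affine_mem_unital {σ : K →+* K} (hσ : ∀ x, σ (σ x) = x) {q : ℕ} (hq : ∀ x, σ x = x ^ q)
    {α β x y : K} :
    Projectivization.mk K ![x, y, 1] (vec1_ne_zero _ _) ∈ unital K q α β ↔
      y - σ y = skewForm σ α β x := by
  simp only [unital, Set.mem_ofPred_eq, mk_affine_ne_inf, or_false, mk_affine_inj, pow_succ, ← hq,
    skewForm]
  constructor
  · rintro ⟨x, r, hr, rfl, rfl⟩
    simp only [map_add, map_mul, hσ, hr, pow_zero, one_mul]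
    ring
  · intro h
    refine ⟨x, y - (α * x ^ 2 + β * (σ x * x)), ?_, rfl, by ring⟩
    simp only [map_add, map_sub, map_mul, map_pow, hσ]
    linear_combination -h

lemma inf_mem_unital (q : ℕ) (α β : K) :
    Projectivization.mk K ![0, 1, 0] vecInf_ne_zero ∈ unital K q α β :=
  Or.inr rfl

lemma mem_unital_cases {q : ℕ} {α β : K} {A : Pt K} (h : A ∈ unital K q α β) :
    (∃ x y : K, A = Projectivization.mk K ![x, y, 1] (vec1_ne_zero _ _)) ∨
      A = Projectivization.mk K ![0, 1, 0] vecInf_ne_zero := by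
  obtain ⟨x, r, -, h⟩ | h := h
  · exact Or.inl ⟨x, _, h⟩
  · exact Or.inr h

lemma mem_pedal_iff {σ : K →+* K} (hσ : ∀ x, σ (σ x) = x) {q : ℕ} (hq : ∀ x, σ x = x ^ q)
    (h2 : (2 : K) ≠ 0) {α β e : K} (he : e ≠ 0) (hσe : σ e = -e)
    (hns : ¬ ∃ s : K, σ s = s ∧ 4 * (σ α * α) + (σ β - β) ^ 2 = s ^ 2) {A : Pt K} :
    A ∈ pedal (unital K q α β) (Projectivization.mk K ![0, e, 1] (vec1_ne_zero _ _)) ↔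
      ∃ a : K, skewForm σ α β a = -2 * e ∧
        A = Projectivization.mk K ![a, e + 2 * α * a ^ 2 + (β - σ β) * (a * σ a), 1]
          (vec1_ne_zero _ _) := by
  have h2e : 2 * e ≠ 0 := mul_ne_zero h2 he
  constructor
  · rintro ⟨hA, hline⟩
    have key : ∀ C, C ∈ lineThrough _ A → C ∈ unital K q α β → C = A :=
      fun C h₁ h₂ => hline.subset ⟨h₁, h₂⟩
    obtain ⟨a, y, rfl⟩ | rfl := mem_unital_cases hA
    · have ha : a ≠ 0 := by
        rintro rfl
        refine mk_affine_ne_inf (key _ (inf_mem_lineThrough_affine.2 ⟨rfl, ?_⟩)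
          (inf_mem_unital q α β)).symm
        rintro rfl
        rw [affine_mem_unital hσ hq, hσe] at hA
        apply h2e
        simp [skewForm] at hA
        linear_combination hA
      rw [affine_mem_unital hσ hq] at hA
      have hy : y - e - 2 * α * a ^ 2 - (β - σ β) * (a * σ a) = 0 := by
        by_contra hw
        set w := y - e - 2 * α * a ^ 2 - (β - σ β) * (a * σ a) with hw_def
        set u := e / w with hu_def
        have hu : u ≠ 0 := div_ne_zero he hw
        have huw : u * w = e := div_mul_cancel₀ e hw
        have hH : skewForm σ α β (u * a) ≠ 0 :=
          fun h => mul_ne_zero hu ha (skewForm_eq_zero hσ hns h)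
        set c := 2 * e / skewForm σ α β (u * a) with hc_def
        have hc : c ≠ 0 := div_ne_zero h2e hH
        have hσc : σ c = c := by
          rw [hc_def, map_div₀, map_skewForm hσ, map_mul, hσe, map_ofNat, mul_neg, neg_div_neg_eq]
        have hcH : c * skewForm σ α β (u * a) = 2 * e := div_mul_cancel₀ _ hH
        have hσuw : σ u * σ w = -e := by rw [← map_mul, huw, hσe]
        have hσw : σ w = σ y + e - 2 * σ α * σ a ^ 2 + (β - σ β) * (a * σ a) := by
          simp only [hw_def, map_sub, map_mul, map_pow, hσ, hσe, map_ofNat]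
          ring
        have h := key _ (affine_mem_lineThrough_affine.2 ⟨1 + c * u, rfl, rfl⟩)
          ((affine_mem_unital hσ hq).2 ?_)
        · have h0 := (mk_affine_inj.1 h).1
          refine mul_ne_zero (mul_ne_zero hc hu) ha ?_
          linear_combination h0
        · rw [hσw] at hσuw
          rw [hw_def] at huw
          simp only [skewForm, map_add, map_sub, map_mul, map_one, map_zero, hσc, hσe]
            at hA hcH ⊢
          linear_combination hA - c * hcH + c * huw - c * hσuw
      have hy' : y = e + 2 * α * a ^ 2 + (β - σ β) * (a * σ a) := by linear_combination hy
      subst hy'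
      refine ⟨a, ?_, rfl⟩
      simp only [skewForm, map_add, map_sub, map_mul, map_pow, hσ, hσe, map_ofNat] at hA ⊢
      linear_combination hA
    · refine absurd (key (Projectivization.mk K ![0, 0, 1] (vec1_ne_zero _ _)) ?_ ?_)
        mk_affine_ne_inf
      · rw [mk_mem_lineThrough]
        refine ⟨1, -e, ?_⟩
        ext i
        fin_cases i <;> simp
      · simp [affine_mem_unital hσ hq, skewForm]
  · rintro ⟨a, hHa, rfl⟩
    have ha : a ≠ 0 := by
      rintro rfl
      apply h2e
      simp [skewForm] at hHa
      simp [hHa]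
    have hmem : Projectivization.mk K ![a, e + 2 * α * a ^ 2 + (β - σ β) * (a * σ a), 1]
        (vec1_ne_zero _ _) ∈ unital K q α β := by
      rw [affine_mem_unital hσ hq]
      simp only [skewForm, map_add, map_sub, map_mul, map_pow, hσ, hσe, map_ofNat] at hHa ⊢
      linear_combination hHa
    refine ⟨hmem, Set.Subset.antisymm ?_ ?_⟩
    · rintro C ⟨hC, hCU⟩
      obtain ⟨x, y, rfl⟩ | rfl := mem_unital_cases hCU
      · obtain ⟨m, rfl, rfl⟩ := affine_mem_lineThrough_affine.1 hC
        rw [affine_mem_unital hσ hq] at hCU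
        have h : skewForm σ α β ((m - 1) * a) = 0 := by
          simp only [skewForm, map_add, map_sub, map_mul, map_pow, map_one, map_zero, hσ, hσe,
            map_ofNat] at hHa hCU ⊢
          linear_combination hHa - hCU
        have hm : m - 1 = 0 := (mul_eq_zero.1 (skewForm_eq_zero hσ hns h)).resolve_right ha
        obtain rfl : m = 1 := by linear_combination hm
        simp
      · exact absurd (inf_mem_lineThrough_affine.1 hC).1.symm ha
    · rintro _ rfl
      exact ⟨affine_mem_lineThrough_affine.2 ⟨1, by ring, by ring⟩, hmem⟩

end Pedal

theorem stmt_19 {K : Type} [Field K] [Fintype K] (p n q : ℕ)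
    (hp : p.Prime) (hpodd : Odd p) (hn : 0 < n) (hq : q = p ^ n)
    (hcard : Fintype.card K = q ^ 2)
    (α β : K) (hα : α ≠ 0)
    (hns : ¬ ∃ s : K, s ^ q = s ∧ 4 * α ^ (q + 1) + (β ^ q - β) ^ 2 = s ^ 2)
    (e : K) (he : e ≠ 0) (heq : e ^ q = -e)
    (O : Set (Pt K))
    (hO : O = ⋃ t ∈ {t : K | t ^ q = t},
        elation K t '' pedal (unital K q α β) (Projectivization.mk K ![0, e, 1] (vec1_ne_zero _ _)))
    (L : K → Set (Pt K))
    (hL : L = fun s => lineThrough (Projectivization.mk K ![1, 0, 0] vec100_ne_zero)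
        (Projectivization.mk K ![0, s - e, 1] (vec1_ne_zero _ _))) :
    O = (⋃ s ∈ {s : K | s ^ q = s}, (L s ∩ unital K q α β)) ∧
    ∀ s s' : K, s ^ q = s → s' ^ q = s' → s ≠ s' →
      Disjoint (L s ∩ unital K q α β) (L s' ∩ unital K q α β) := by
  have := Fact.mk hp
  have hchar : CharP K p := charP_of_card_eq_prime_pow (f := n * 2) (by
    rw [hcard, hq, pow_mul])
  have h2 : (2 : K) ≠ 0 := by
    apply Ring.two_ne_zero
    rw [ringChar.eq K p]
    rintro rfl
    exact absurd hpodd (by decide)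
  obtain ⟨σ, hσq⟩ : ∃ σ : K →+* K, ∀ x, σ x = x ^ q :=
    ⟨iterateFrobenius K p n, fun x => by rw [iterateFrobenius_def, hq]⟩
  have hσ : ∀ x, σ (σ x) = x := fun x => by
    rw [hσq, hσq, ← pow_mul, ← sq, ← hcard, FiniteField.pow_card]
  simp only [pow_succ α q, ← hσq] at hns heq hO ⊢
  subst hO hL
  refine ⟨?_, ?_⟩
  · ext A
    simp only [Set.mem_iUnion, Set.mem_image, Set.mem_ofPred_eq, Set.mem_inter_iff, exists_prop,
      mem_pedal_iff hσ hσq h2 he heq hns]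
    constructor
    · rintro ⟨t, ht, _, ⟨a, ha, rfl⟩, rfl⟩
      rw [elation_mk_affine]
      refine ⟨e + 2 * α * a ^ 2 + (β - σ β) * (a * σ a) + t + e, ?_,
        affine_mem_lineThrough_horizontal.2 (by ring), (affine_mem_unital hσ hσq).2 ?_⟩
      all_goals
        simp only [skewForm, map_add, map_sub, map_mul, map_pow, hσ, heq, ht, map_ofNat] at ha ⊢
      · linear_combination -2 * ha
      · linear_combination ha
    · rintro ⟨s, hs, hline, hU⟩
      obtain ⟨x, y, rfl⟩ | rfl := mem_unital_cases hU
      · obtain rfl := affine_mem_lineThrough_horizontal.1 hline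
        rw [affine_mem_unital hσ hσq, map_sub, hs, heq] at hU
        refine ⟨s - e - (e + 2 * α * x ^ 2 + (β - σ β) * (x * σ x)), ?_, _,
          ⟨x, by linear_combination -hU, rfl⟩, ?_⟩
        · simp only [skewForm, map_add, map_sub, map_mul, map_pow, hσ, heq, hs, map_ofNat] at hU ⊢
          linear_combination -2 * hU
        · rw [elation_mk_affine, add_sub_cancel]
      · exact absurd hline inf_notMem_lineThrough_horizontal
  · intro s s' _ _ hne
    rw [Set.disjoint_left]
    rintro A ⟨hs, hU⟩ ⟨hs', -⟩
    obtain ⟨x, y, rfl⟩ | rfl := mem_unital_cases hU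
    · have h := affine_mem_lineThrough_horizontal.1 hs
      rw [affine_mem_lineThrough_horizontal.1 hs'] at h
      exact hne (sub_left_injective h).symm
    · exact inf_notMem_lineThrough_horizontal hs
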